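/- arXiv:math-ph/0008036 — 3 statements merged into one kernel-verified Lean document; each statement's English description precedes it below -/
import Mathlib

section
/- Let G and H be groupoids with left Haar systems, and let M be a left principal G–H bibundle. Then for every r ∈ H₀ the measure μ^r on the fiber σ⁻¹(r) is well defined: for any two points m₀, m₁ ∈ σ⁻¹(r) and any positive measurable function f on M for which the integrals are finite, ∫ f(x⁻¹m₀) dν^{τ(m₀)}(x) = ∫ f(x⁻¹m₁) dν^{τ(m₁)}(x). -/
open MeasureTheory ComplexConjugate
open scoped ENNReal

/-- An (algebraic) groupoid, with multiplication given as a total function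
that is only meaningful on composable pairs, i.e. when `src x = tgt y`. -/
structure PGroupoid (A O : Type*) where
  src : A → O
  tgt : A → O
  mul : A → A → A
  inv : A → A
  unit : O → A
  src_unit : ∀ u, src (unit u) = u
  tgt_unit : ∀ u, tgt (unit u) = u
  src_mul : ∀ x y, src x = tgt y → src (mul x y) = src y
  tgt_mul : ∀ x y, src x = tgt y → tgt (mul x y) = tgt x
  mul_assoc : ∀ x y z, src x = tgt y → src y = tgt z →
    mul (mul x y) z = mul x (mul y z)
  unit_mul : ∀ x, mul (unit (tgt x)) x = x
  mul_unit : ∀ x, mul x (unit (src x)) = x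
  src_inv : ∀ x, src (inv x) = tgt x
  tgt_inv : ∀ x, tgt (inv x) = src x
  inv_inv : ∀ x, inv (inv x) = x
  mul_inv : ∀ x, mul x (inv x) = unit (tgt x)
  inv_mul : ∀ x, mul (inv x) x = unit (src x)
  inv_mul_eq : ∀ x y, src x = tgt y → inv (mul x y) = mul (inv y) (inv x)

/-- A left Haar system on a groupoid: a family of measures `meas u` on the arrows,
supported on the `tgt`-fiber over `u`, and left invariant. -/
structure HaarSystem {A O : Type*} [MeasurableSpace A] (G : PGroupoid A O) where
  meas : O → MeasureTheory.Measure A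
  supported : ∀ u, meas u {y | G.tgt y ≠ u} = 0
  left_invariant : ∀ (x : A) (f : A → ℝ≥0∞), Measurable f →
    ∫⁻ y, f (G.mul x y) ∂ (meas (G.src x)) = ∫⁻ y, f y ∂ (meas (G.tgt x))
/-- A `G`-`H` bibundle structure on a set `M`: base maps `τ`, `σ`, a left `G`-action and a
right `H`-action (total functions, meaningful only when the composability conditions hold),
satisfying the usual axioms. -/
structure Bibundle {A O B P : Type*} (G : PGroupoid A O) (H : PGroupoid B P)
    (M : Type*) where
  τ : M → O
  σ : M → P
  lact : A → M → M
  ract : M → B → M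
  τ_lact : ∀ x m, G.src x = τ m → τ (lact x m) = G.tgt x
  σ_lact : ∀ x m, G.src x = τ m → σ (lact x m) = σ m
  τ_ract : ∀ m h, σ m = H.tgt h → τ (ract m h) = τ m
  σ_ract : ∀ m h, σ m = H.tgt h → σ (ract m h) = H.src h
  lact_mul : ∀ x y m, G.src x = G.tgt y → G.src y = τ m →
    lact (G.mul x y) m = lact x (lact y m)
  lact_unit : ∀ m, lact (G.unit (τ m)) m = m
  ract_mul : ∀ m h l, σ m = H.tgt h → H.src h = H.tgt l →
    ract m (H.mul h l) = ract (ract m h) l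
  ract_unit : ∀ m, ract m (H.unit (σ m)) = m
  lact_ract : ∀ x m h, G.src x = τ m → σ m = H.tgt h →
    ract (lact x m) h = lact x (ract m h)

/-- For a left principal `G`-`H` bibundle `M`, the measure `μ^r` on the
fiber `σ⁻¹(r)` is well defined: its defining formula does not depend on the chosen base
point `m₀ ∈ σ⁻¹(r)`. -/
theorem stmt_0 {A O B P M : Type*}
    [MeasurableSpace A] [MeasurableSpace B] [MeasurableSpace M]
    (G : PGroupoid A O) (H : PGroupoid B P)
    (ν : HaarSystem G) (lam : HaarSystem H)
    (Mb : Bibundle G H M)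
    -- `M` is left principal: the `G`-action is free and transitive along the fibers of `σ`
    (hfree : ∀ x m, G.src x = Mb.τ m → Mb.lact x m = m → x = G.unit (Mb.τ m))
    (htrans : ∀ m m', Mb.σ m = Mb.σ m' → ∃ x, G.src x = Mb.τ m ∧ m' = Mb.lact x m)
    -- measurability of the structure maps
    (hmul : Measurable fun p : A × A => G.mul p.1 p.2)
    (hinv : Measurable G.inv)
    (hlact : Measurable fun p : A × M => Mb.lact p.1 p.2) :
    ∀ (r : P) (m₀ m₁ : M), Mb.σ m₀ = r → Mb.σ m₁ = r →
      ∀ f : M → ℝ≥0∞, Measurable f →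
        ∫⁻ x, f (Mb.lact (G.inv x) m₀) ∂ (ν.meas (Mb.τ m₀))
          = ∫⁻ x, f (Mb.lact (G.inv x) m₁) ∂ (ν.meas (Mb.τ m₁)) := by
  intro r m₀ m₁ h₀ h₁ f hf
  obtain ⟨x, hx, rfl⟩ := htrans m₀ m₁ (h₀.trans h₁.symm)
  have hmeas : Measurable fun y => f (Mb.lact (G.inv y) (Mb.lact x m₀)) :=
    hf.comp (hlact.comp (hinv.prodMk measurable_const))
  rw [Mb.τ_lact x m₀ hx, ← ν.left_invariant x _ hmeas, hx]
  have hsupp : ∀ᵐ y ∂(ν.meas (Mb.τ m₀)), G.tgt y = Mb.τ m₀ :=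
    ae_iff.2 (ν.supported (Mb.τ m₀))
  refine lintegral_congr_ae ?_
  filter_upwards [hsupp] with y hy
  have hxy : G.src x = G.tgt y := hx.trans hy.symm
  rw [G.inv_mul_eq x y hxy,
    Mb.lact_mul _ _ _ (by rw [G.src_inv, G.tgt_inv, hxy]) (by rw [G.src_inv, Mb.τ_lact x m₀ hx]),
    ← Mb.lact_mul (G.inv x) x m₀ (G.src_inv x) hx, G.inv_mul, hx, Mb.lact_unit]
end

section
/- Let G and H be groupoids with left Haar systems, and let M be a left principal G–H bibundle. Then the family of measures {μ^r}_{r∈H₀} on M is H-equivariant: for every h ∈ H₁ and every positive measurable function f on M for which the integrals are finite, ∫ f(mh) dμ^{t(h)}(m) = ∫ f(m) dμ^{s(h)}(m). -/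
open MeasureTheory ComplexConjugate
open scoped ENNReal

/-- For a left principal `G`-`H` bibundle `M`, the induced family of
measures `{μ^r}_{r ∈ H₀}` on `M` is `H`-equivariant:
`∫ f(mh) dμ^{t(h)}(m) = ∫ f(m) dμ^{s(h)}(m)`. -/
theorem stmt_1 {A O B P M : Type*}
    [MeasurableSpace A] [MeasurableSpace B] [MeasurableSpace M]
    (G : PGroupoid A O) (H : PGroupoid B P)
    (ν : HaarSystem G) (lam : HaarSystem H)
    (Mb : Bibundle G H M)
    -- `M` is left principal (with `σ` surjective)
    (hσsurj : Function.Surjective Mb.σ)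
    (hfree : ∀ x m, G.src x = Mb.τ m → Mb.lact x m = m → x = G.unit (Mb.τ m))
    (htrans : ∀ m m', Mb.σ m = Mb.σ m' → ∃ x, G.src x = Mb.τ m ∧ m' = Mb.lact x m)
    -- measurability of the structure maps
    (hmul : Measurable fun p : A × A => G.mul p.1 p.2)
    (hinv : Measurable G.inv)
    (hlact : Measurable fun p : A × M => Mb.lact p.1 p.2)
    (hract : Measurable fun p : M × B => Mb.ract p.1 p.2)
    -- the induced family of measures on `M`
    (μ : P → Measure M)
    (hμ : ∀ m₀ : M, μ (Mb.σ m₀)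
      = Measure.map (fun x => Mb.lact (G.inv x) m₀) (ν.meas (Mb.τ m₀))) :
    ∀ (h : B) (f : M → ℝ≥0∞), Measurable f →
      ∫⁻ m, f (Mb.ract m h) ∂ (μ (H.tgt h)) = ∫⁻ m, f m ∂ (μ (H.src h)) := by
  intro h f hf
  obtain ⟨m₀, hm₀⟩ := hσsurj (H.tgt h)
  have meas_orbit : ∀ m : M, Measurable fun x => Mb.lact (G.inv x) m := fun m =>
    hlact.comp (hinv.prodMk measurable_const)
  have meas_ract : Measurable fun m => f (Mb.ract m h) :=
    hf.comp (hract.comp (measurable_id.prodMk measurable_const))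
  rw [← hm₀, ← Mb.σ_ract m₀ h hm₀, hμ m₀, hμ (Mb.ract m₀ h), Mb.τ_ract m₀ h hm₀,
    lintegral_map meas_ract (meas_orbit m₀), lintegral_map hf (meas_orbit _)]
  have h_tgt : ∀ᵐ x ∂(ν.meas (Mb.τ m₀)), G.tgt x = Mb.τ m₀ :=
    ae_iff.2 (ν.supported (Mb.τ m₀))
  refine lintegral_congr_ae ?_
  filter_upwards [h_tgt] with x hx
  rw [Mb.lact_ract _ _ _ ((G.src_inv x).trans hx) hm₀]
end

section
/- Let G and H be groupoids with left Haar systems and let M be a left principal G–H bibundle. For functions φ, ψ on M and every h ∈ H₁, the inner product ⟨φ,ψ⟩ satisfies ⟨φ,ψ⟩*(h) = ⟨ψ,φ⟩(h); explicitly, conj( ∫ conj(φ(m)) ψ(m h⁻¹) dμ^{s(h)}(m) ) = ∫ conj(ψ(m)) φ(mh) dμ^{t(h)}(m). -/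
open MeasureTheory ComplexConjugate
open scoped ENNReal

/-- For a left principal `G`-`H` bibundle `M`, the inner product
`⟨φ,ψ⟩(h) = ∫ conj(φ(m)) ψ(mh) dμ^{t(h)}(m)` satisfies `⟨φ,ψ⟩*(h) = ⟨ψ,φ⟩(h)`. -/
theorem stmt_2 {A O B P M : Type*}
    [MeasurableSpace A] [MeasurableSpace B] [MeasurableSpace M]
    (G : PGroupoid A O) (H : PGroupoid B P)
    (ν : HaarSystem G) (lam : HaarSystem H)
    (Mb : Bibundle G H M)
    -- `M` is left principal (with `σ` surjective)
    (hσsurj : Function.Surjective Mb.σ)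
    (hfree : ∀ x m, G.src x = Mb.τ m → Mb.lact x m = m → x = G.unit (Mb.τ m))
    (htrans : ∀ m m', Mb.σ m = Mb.σ m' → ∃ x, G.src x = Mb.τ m ∧ m' = Mb.lact x m)
    -- measurability of the structure maps
    (hmul : Measurable fun p : A × A => G.mul p.1 p.2)
    (hinv : Measurable G.inv)
    (hHinv : Measurable H.inv)
    (hlact : Measurable fun p : A × M => Mb.lact p.1 p.2)
    (hract : Measurable fun p : M × B => Mb.ract p.1 p.2)
    -- the induced family of measures on `M`
    (μ : P → Measure M)
    (hμ : ∀ m₀ : M, μ (Mb.σ m₀)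
      = Measure.map (fun x => Mb.lact (G.inv x) m₀) (ν.meas (Mb.τ m₀))) :
    ∀ (h : B) (φ ψ : M → ℂ), Measurable φ → Measurable ψ →
      Integrable (fun m => conj (φ m) * ψ (Mb.ract m (H.inv h))) (μ (H.src h)) →
      Integrable (fun m => conj (ψ m) * φ (Mb.ract m h)) (μ (H.tgt h)) →
      conj (∫ m, conj (φ m) * ψ (Mb.ract m (H.inv h)) ∂ (μ (H.src h)))
        = ∫ m, conj (ψ m) * φ (Mb.ract m h) ∂ (μ (H.tgt h)) := by
  intro h φ ψ _ _ hint₁ hint₂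
  obtain ⟨m₀, hm₀⟩ := hσsurj (H.tgt h)
  have hmeas : ∀ m : M, Measurable fun x => Mb.lact (G.inv x) m := fun m =>
    hlact.comp (hinv.prodMk measurable_const)
  have hsrc : μ (H.src h)
      = Measure.map (fun x => Mb.lact (G.inv x) (Mb.ract m₀ h)) (ν.meas (Mb.τ m₀)) := by
    have := hμ (Mb.ract m₀ h)
    rwa [Mb.σ_ract _ _ hm₀, Mb.τ_ract _ _ hm₀] at this
  have htgt : μ (H.tgt h)
      = Measure.map (fun x => Mb.lact (G.inv x) m₀) (ν.meas (Mb.τ m₀)) := hm₀ ▸ hμ m₀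
  rw [hsrc] at hint₁ ⊢
  rw [htgt] at hint₂ ⊢
  rw [integral_map (hmeas _).aemeasurable hint₁.aestronglyMeasurable,
    integral_map (hmeas _).aemeasurable hint₂.aestronglyMeasurable, ← integral_conj]
  have hsupp : ∀ᵐ x ∂(ν.meas (Mb.τ m₀)), G.tgt x = Mb.τ m₀ := ν.supported (Mb.τ m₀)
  refine integral_congr_ae ?_
  filter_upwards [hsupp] with x hx
  have hcomp : G.src (G.inv x) = Mb.τ m₀ := (G.src_inv x).trans hx
  have hσ : Mb.σ (Mb.lact (G.inv x) m₀) = H.tgt h := (Mb.σ_lact _ _ hcomp).trans hm₀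
  have hcancel : Mb.ract (Mb.ract (Mb.lact (G.inv x) m₀) h) (H.inv h)
      = Mb.lact (G.inv x) m₀ := by
    rw [← Mb.ract_mul _ _ _ hσ (H.tgt_inv h).symm, H.mul_inv, ← hσ, Mb.ract_unit]
  rw [← Mb.lact_ract _ _ _ hcomp hm₀, hcancel, map_mul, Complex.conj_conj, mul_comm]
end
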